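/- Assume F is algebraically closed. Let W be a G-graded simple left R-module. Then the following conditions are equivalent: (i) C(W) contains a maximal graded subfield that is isomorphic, as a graded algebra, to the group algebra of its support H, where |H| is finite and not divisible by char F; (ii) dim_F C(W) is finite and not divisible by char F. Moreover, under these equivalent conditions, W is completely reducible as an ungraded R-module. -/

import Mathlib

/-! Common definitions: gradings on algebras and modules, graded simplicity,
homogeneous endomorphisms, graded subfields, and loop modules. -/

noncomputable section

namespace GradedPaper

variable {F : Type*} [Field F]

/-- `ℳ` is a direct sum decomposition of the `F`-vector space `V`:
every vector is a finite sum of homogeneous components, and such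
decompositions are unique (independence). -/
def IsVSDecomp {V ι : Type*} [AddCommGroup V] [Module F V]
    (ℳ : ι → Submodule F V) : Prop :=
  (∀ v : V, ∃ (t : Finset ι) (c : ι → V), (∀ i ∈ t, c i ∈ ℳ i) ∧ v = ∑ i ∈ t, c i) ∧
  (∀ (t : Finset ι) (c : ι → V), (∀ i ∈ t, c i ∈ ℳ i) → ∑ i ∈ t, c i = 0 →
    ∀ i ∈ t, c i = 0)

/-- A `G`-grading on a unital associative `F`-algebra `R`:
`R = ⊕_{g ∈ G} R_g` with `1 ∈ R_0` and `R_g · R_h ⊆ R_{g+h}`.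
(The abelian grading group is written additively.) -/
structure AlgebraGrading (F : Type*) [Field F] (G : Type*) [AddCommGroup G]
    (R : Type*) [Ring R] [Algebra F R] where
  comp : G → Submodule F R
  decomp : IsVSDecomp comp
  one_mem : (1 : R) ∈ comp 0
  mul_mem : ∀ {g h : G} {r s : R}, r ∈ comp g → s ∈ comp h → r * s ∈ comp (g + h)

variable {G : Type*} [AddCommGroup G] {R : Type*} [Ring R] [Algebra F R]

/-- A grading of a left `R`-module `V` by the group `κ`, compatible with the
`G`-grading `𝒜` of `R` along the homomorphism `p : G →+ κ`
(so `R_g · V_k ⊆ V_{p g + k}`).  For `p = id` this is a `G`-graded module;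
for `p : G →+ G ⧸ H` the natural projection, this is a `G/H`-graded module
(for the induced `G/H`-grading of `R`). -/
structure ModuleGrading (𝒜 : AlgebraGrading F G R) {κ : Type*} [AddCommGroup κ]
    (p : G →+ κ) (V : Type*) [AddCommGroup V] [Module F V] [Module R V]
    [IsScalarTower F R V] where
  comp : κ → Submodule F V
  decomp : IsVSDecomp comp
  smul_mem : ∀ {g : G} {k : κ} {r : R} {v : V},
    r ∈ 𝒜.comp g → v ∈ comp k → r • v ∈ comp (p g + k)

/-- `W` is a graded submodule: every element of `W` is a finite sum of
homogeneous elements of `W`. -/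
def IsGradedSubmodule {κ V : Type*} [AddCommGroup V] [Module F V] [Module R V]
    (ℳ : κ → Submodule F V) (W : Submodule R V) : Prop :=
  ∀ w ∈ W, ∃ (t : Finset κ) (c : κ → V),
    (∀ i ∈ t, c i ∈ ℳ i ∧ c i ∈ W) ∧ w = ∑ i ∈ t, c i

/-- The graded module with components `ℳ` is graded simple. -/
def IsGradedSimpleModule (R : Type*) [Ring R] {κ V : Type*} [AddCommGroup V]
    [Module F V] [Module R V] (ℳ : κ → Submodule F V) : Prop :=
  (∃ v : V, v ≠ 0) ∧ ∀ W : Submodule R V, IsGradedSubmodule ℳ W → W = ⊥ ∨ W = ⊤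

/-- An `R`-module endomorphism of `V` is homogeneous of degree `d`. -/
def IsHomogeneousEnd {κ V : Type*} [Add κ] [AddCommGroup V] [Module F V]
    [Module R V] (ℳ : κ → Submodule F V) (d : κ) (f : Module.End R V) : Prop :=
  ∀ ⦃k : κ⦄ ⦃v : V⦄, v ∈ ℳ k → f v ∈ ℳ (k + d)

/-- The degree-`d` homogeneous component of the (graded) centralizer
`C(V) = End_R(V)`. -/
def homogComp {κ V : Type*} [Add κ] [AddCommGroup V] [Module F V] [Module R V]
    [SMulCommClass R F V] (ℳ : κ → Submodule F V) (d : κ) :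
    Submodule F (Module.End R V) where
  carrier := {f | IsHomogeneousEnd ℳ d f}
  add_mem' := fun hf hg k v hv => (ℳ _).add_mem (hf hv) (hg hv)
  zero_mem' := fun k v hv => (ℳ _).zero_mem
  smul_mem' := fun c f hf k v hv => by
    simpa using (ℳ _).smul_mem c (hf hv)

/-- `f` belongs to the graded centralizer: it is a finite sum of homogeneous
`R`-module endomorphisms. -/
def IsInGradedCentralizer {κ V : Type*} [Add κ] [AddCommGroup V] [Module F V]
    [Module R V] (ℳ : κ → Submodule F V) (f : Module.End R V) : Prop :=
  ∃ (t : Finset κ) (c : κ → Module.End R V),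
    (∀ d ∈ t, IsHomogeneousEnd ℳ d (c d)) ∧ f = ∑ d ∈ t, c d

/-- The module `V` is central (Schurian): its centralizer consists of the
scalar multiples of the identity. -/
def IsCentralModule (F : Type*) [Field F] (R V : Type*) [Ring R] [AddCommGroup V]
    [Module F V] [Module R V] : Prop :=
  ∀ f : Module.End R V, ∃ a : F, ∀ v : V, f v = a • v

/-- A graded subfield of a graded algebra with homogeneous components `𝒟`:
a graded unital subalgebra (given by its homogeneous components `comp`)
which is commutative and in which every nonzero homogeneous element is
invertible. -/
structure GradedSubfield {κ : Type*} [AddCommGroup κ] {A : Type*} [Ring A]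
    [Module F A] (𝒟 : κ → Submodule F A) where
  comp : κ → Submodule F A
  le : ∀ k, comp k ≤ 𝒟 k
  one_mem : (1 : A) ∈ comp 0
  mul_mem : ∀ {g h : κ} {a b : A}, a ∈ comp g → b ∈ comp h → a * b ∈ comp (g + h)
  comm : ∀ {g h : κ} {a b : A}, a ∈ comp g → b ∈ comp h → a * b = b * a
  inv_mem : ∀ {g : κ} {a : A}, a ∈ comp g → a ≠ 0 →
    ∃ b ∈ comp (-g), a * b = 1 ∧ b * a = 1

/-- The support of a graded subfield. -/
def GradedSubfield.support {κ : Type*} [AddCommGroup κ] {A : Type*} [Ring A]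
    [Module F A] {𝒟 : κ → Submodule F A} (𝒦 : GradedSubfield 𝒟) : Set κ :=
  {k | 𝒦.comp k ≠ ⊥}

/-- A graded subfield is maximal if the only graded subfield containing it
is itself. -/
def GradedSubfield.IsMaximal {κ : Type*} [AddCommGroup κ] {A : Type*} [Ring A]
    [Module F A] {𝒟 : κ → Submodule F A} (𝒦 : GradedSubfield 𝒟) : Prop :=
  ∀ 𝒦' : GradedSubfield 𝒟, (∀ k, 𝒦.comp k ≤ 𝒦'.comp k) → ∀ k, 𝒦'.comp k = 𝒦.comp k

/-- A graded subfield is isomorphic, as a graded algebra, to the group algebra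
of its support: it has a homogeneous basis `c` (one-dimensional components)
which is multiplicative. -/
def GradedSubfield.IsGroupAlgebraOfSupport {κ : Type*} [AddCommGroup κ]
    {A : Type*} [Ring A] [Module F A] {𝒟 : κ → Submodule F A}
    (𝒦 : GradedSubfield 𝒟) : Prop :=
  ∃ c : κ → A, c 0 = 1 ∧
    (∀ k ∈ 𝒦.support, c k ∈ 𝒦.comp k ∧ c k ≠ 0 ∧ 𝒦.comp k = Submodule.span F {c k}) ∧
    (∀ k₁ ∈ 𝒦.support, ∀ k₂ ∈ 𝒦.support, c (k₁ + k₂) = c k₁ * c k₂)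

section Loop

variable {Q₁ Q₂ : Type*}

/-- The underlying space of the loop module: inside `V ⊗ F[Q₁] ≅ (Q₁ →₀ V)`,
the subspace `⊕_{a ∈ Q₁} V_{s a} ⊗ a` of finitely supported functions `f` with
`f a ∈ V_{s a}`. -/
def LoopSubmodule {V : Type*} [AddCommGroup V] [Module F V] (s : Q₁ → Q₂)
    (ℳ : Q₂ → Submodule F V) : Submodule F (Q₁ →₀ V) where
  carrier := {f | ∀ a : Q₁, f a ∈ ℳ (s a)}
  add_mem' := fun hf hg a => by simpa using (ℳ _).add_mem (hf a) (hg a)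
  zero_mem' := fun a => by simpa using (ℳ _).zero_mem
  smul_mem' := fun c f hf a => by simpa using (ℳ _).smul_mem c (hf a)

/-- The degree-`a` homogeneous component of the loop module. -/
def loopComp {V : Type*} [AddCommGroup V] [Module F V] (s : Q₁ → Q₂)
    (ℳ : Q₂ → Submodule F V) (a : Q₁) : Submodule F ↥(LoopSubmodule s ℳ) where
  carrier := {x | ∀ b : Q₁, b ≠ a → (x : Q₁ →₀ V) b = 0}
  add_mem' := by
    intro x y hx hy b hb
    simp [hx b hb, hy b hb]
  zero_mem' := by intro b hb; simp
  smul_mem' := by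
    intro c x hx b hb
    simp [hx b hb]

/-- The scalar multiplication of a (possibly non-canonical) module structure,
written explicitly. -/
def msmul {S M : Type*} [Semiring S] [AddCommMonoid M] (i : Module S M)
    (r : S) (x : M) : M :=
  @SMul.smul S M i.toDistribMulAction.toMulAction.toSMul r x

/-- `i` is the loop-module `R`-action: a homogeneous element `r ∈ R_g` acts on
`v ⊗ a` by `r • (v ⊗ a) = (r v) ⊗ (p g + a)`; in terms of values of finitely
supported functions, `(r • x) a = r • x (a - p g)`. -/
def IsLoopSMul [AddCommGroup Q₁] (𝒜 : AlgebraGrading F G R) (p : G →+ Q₁)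
    (s : Q₁ → Q₂) {V : Type*} [AddCommGroup V] [Module F V] [Module R V]
    (ℳ : Q₂ → Submodule F V) (i : Module R ↥(LoopSubmodule s ℳ)) : Prop :=
  ∀ {g : G} {r : R}, r ∈ 𝒜.comp g → ∀ (x : ↥(LoopSubmodule s ℳ)) (a : Q₁),
    ((msmul i r x : ↥(LoopSubmodule s ℳ)) : Q₁ →₀ V) a = r • ((x : Q₁ →₀ V) (a - p g))

/-- The right-shift operator `1 ⊗ d` on the loop module:
`v ⊗ a ↦ v ⊗ (a + d)`. -/
def rshiftFun [AddCommGroup Q₁] {V : Type*} [AddCommGroup V] [Module F V]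
    (s : Q₁ → Q₂) (ℳ : Q₂ → Submodule F V) (d : Q₁) (hd : ∀ a, s (a + d) = s a) :
    ↥(LoopSubmodule s ℳ) → ↥(LoopSubmodule s ℳ) :=
  fun x => ⟨Finsupp.equivMapDomain (Equiv.addRight d) (x : Q₁ →₀ V), by
    intro a
    have key : Finsupp.equivMapDomain (Equiv.addRight d) (x : Q₁ →₀ V) a
        = (x : Q₁ →₀ V) (a - d) := by
      rw [Finsupp.equivMapDomain_apply]
      congr 1
      simp [sub_eq_add_neg]
    rw [key]
    have h1 : s (a - d) = s a := by
      have h2 := hd (a - d)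
      rw [show a - d + d = a by abel] at h2
      exact h2.symm
    exact h1 ▸ x.2 (a - d)⟩

end Loop

section Twist

variable (H : AddSubgroup G)

/-- `i` is the `R`-module structure on (the finitely-supported-functions model
`{f : G/H →₀ V | f q ∈ V_q}` of) the `G/H`-graded module `V`, twisted by the
scalar factors `cf`: a homogeneous `r ∈ R_g` acts on `v ∈ V_k` by
`r • v = cf g k • (r v) ∈ V_{ḡ + k}`. -/
def IsTwistedSMul (𝒜 : AlgebraGrading F G R) {V : Type*} [AddCommGroup V]
    [Module F V] [Module R V] (ℳ : G ⧸ H → Submodule F V) (cf : G → G ⧸ H → F)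
    (i : Module R ↥(LoopSubmodule (id : G ⧸ H → G ⧸ H) ℳ)) : Prop :=
  ∀ {g : G} {r : R}, r ∈ 𝒜.comp g → ∀ (x : ↥(LoopSubmodule (id : G ⧸ H → G ⧸ H) ℳ))
    (q : G ⧸ H),
    ((msmul i r x : ↥(LoopSubmodule (id : G ⧸ H → G ⧸ H) ℳ)) : (G ⧸ H) →₀ V) q
      = cf g (q - QuotientAddGroup.mk g) •
          (r • ((x : (G ⧸ H) →₀ V) (q - QuotientAddGroup.mk g)))

end Twist

section Pregrading

/-- A `G`-pregrading of the left `R`-module `V`: a family of subspaces with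
`V = Σ_g V_g` and `R_g · V_h ⊆ V_{g+h}`. -/
def IsPregrading (𝒜 : AlgebraGrading F G R) {V : Type*} [AddCommGroup V]
    [Module F V] [Module R V] (P : G → Submodule F V) : Prop :=
  (⨆ g, P g) = (⊤ : Submodule F V) ∧
  ∀ {g k : G} {r : R} {v : V}, r ∈ 𝒜.comp g → v ∈ P k → r • v ∈ P (g + k)

/-- A pregrading is thin if it admits no proper refinement. -/
def IsThinPregrading (𝒜 : AlgebraGrading F G R) {V : Type*} [AddCommGroup V]
    [Module F V] [Module R V] (P : G → Submodule F V) : Prop :=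
  IsPregrading 𝒜 P ∧
  ∀ P' : G → Submodule F V, IsPregrading 𝒜 P' → (∀ g, P' g ≤ P g) → P' = P

end Pregrading

section Extras

open TensorProduct

variable {G : Type*} [AddCommGroup G] {R : Type*} [Ring R] [Algebra F R]

lemma mk'_add_right_mem (H : AddSubgroup G) (h : ↥H) (a : G) :
    (QuotientAddGroup.mk' H) (a + (h : G)) = (QuotientAddGroup.mk' H) a := by
  simpa using QuotientAddGroup.mk_add_of_mem a h.2

/-- The right-shift operator `1 ⊗ h`, `h ∈ H`, on the loop module `L_π(V)`
(for `π : G → G/H` the natural projection): `v ⊗ g ↦ v ⊗ (g + h)`. -/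
def loopShift (H : AddSubgroup G) {V : Type*} [AddCommGroup V] [Module F V]
    (ℳ : G ⧸ H → Submodule F V) (h : ↥H) :
    ↥(LoopSubmodule (⇑(QuotientAddGroup.mk' H)) ℳ) →
      ↥(LoopSubmodule (⇑(QuotientAddGroup.mk' H)) ℳ) :=
  rshiftFun (⇑(QuotientAddGroup.mk' H)) ℳ (h : G) (mk'_add_right_mem H h)

lemma twist_elt_mem (H : AddSubgroup G) (ξ : G ⧸ H → G)
    (hξ : ∀ q, (QuotientAddGroup.mk' H) (ξ q) = q) (g : G) (k : G ⧸ H) :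
    g + ξ k - ξ ((QuotientAddGroup.mk' H) g + k) ∈ H := by
  have h0 : (QuotientAddGroup.mk' H) (g + ξ k - ξ ((QuotientAddGroup.mk' H) g + k)) = 0 := by
    rw [map_sub, map_add, hξ, hξ]
    abel
  exact (QuotientAddGroup.eq_zero_iff _).mp h0

/-- The scalar factors `χ(g + ξ(k̄) - ξ(ḡ + k̄))` defining the module `V`
twisted by a character `χ` of `H`, relative to the section `ξ` of the natural
projection `π : G → G/H`. -/
def twistFactor (H : AddSubgroup G) (ξ : G ⧸ H → G)
    (hξ : ∀ q, (QuotientAddGroup.mk' H) (ξ q) = q) (χ : AddChar ↥H Fˣ) :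
    G → G ⧸ H → F :=
  fun g k =>
    ((χ ⟨g + ξ k - ξ ((QuotientAddGroup.mk' H) g + k), twist_elt_mem H ξ hξ g k⟩ : Fˣ) : F)

/-- The `G/H`-grading induced on a quotient `W/N` of a `G`-graded module `W`:
the component of degree `ḡ` is the image of `⊕_{h ∈ H} W_{g+h}`. -/
def quotGradeComp {W : Type*} [AddCommGroup W] [Module F W] [Module R W]
    [IsScalarTower F R W] (H : AddSubgroup G) (ℳ : G → Submodule F W)
    (N : Submodule R W) : G ⧸ H → Submodule F (W ⧸ N) :=
  fun q => ⨆ g : {g : G // (QuotientAddGroup.mk' H) g = q},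
    (ℳ (g : G)).map ((N.mkQ).restrictScalars F)

/-- The submodule `W · ker ρ` of `W`, where `ρ` is the homomorphism of unital
algebras `𝓕 → F` determined by `ρ(c_h) = ρ h` on the multiplicative
homogeneous basis `c` of the graded subfield `𝓕 ≅ FH` of the centralizer:
`W · ker ρ = Σ_{h ∈ H} W·(c_h - ρ(h)·1)`. -/
def kerSubmodule {W : Type*} [AddCommGroup W] [Module F W] [Module R W]
    [SMulCommClass R F W] {H : AddSubgroup G} (c : ↥H → Module.End R W)
    (ρ : ↥H → F) : Submodule R W :=
  ⨆ h : ↥H, LinearMap.range (c h - ρ h • (1 : Module.End R W))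

/-- The grading of the coordinate space `ι' → F` with coordinates of degrees
`gdeg`. -/
def coordComp {ι' : Type*} (gdeg : ι' → G) (g : G) : Submodule F (ι' → F) where
  carrier := {x | ∀ i, gdeg i ≠ g → x i = 0}
  add_mem' := fun hx hy i hi => by
    simp only [Pi.add_apply, hx i hi, hy i hi, add_zero]
  zero_mem' := fun i hi => rfl
  smul_mem' := fun a x hx i hi => by
    simp only [Pi.smul_apply, hx i hi, smul_zero]

/-- The natural grading of a tensor product of two graded algebras (or graded
vector spaces): the component of degree `g` is spanned by the products
`a ⊗ b` of homogeneous elements with `deg a + deg b = g`. -/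
def tensorGradeComp {A B : Type*} [AddCommGroup A] [Module F A] [AddCommGroup B]
    [Module F B] (Ac : G → Submodule F A) (Bc : G → Submodule F B) (g : G) :
    Submodule F (A ⊗[F] B) :=
  Submodule.span F {x | ∃ (g₁ g₂ : G) (a : A) (b : B),
    g₁ + g₂ = g ∧ a ∈ Ac g₁ ∧ b ∈ Bc g₂ ∧ x = a ⊗ₜ[F] b}

/-- The action of `r ∈ R` on an `R`-module `V`, viewed as an `F`-linear
endomorphism of `V`; i.e. the representation `R → End_F(V)`. -/
def actionEnd (F : Type*) [Field F] {R V : Type*} [Ring R] [AddCommGroup V]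
    [Module F V] [Module R V] [SMulCommClass R F V] (r : R) : Module.End F V where
  toFun v := r • v
  map_add' := smul_add r
  map_smul' a v := by simpa using smul_comm r a v

end Extras

end GradedPaper

namespace GradedPaper

universe u_K

section Helpers

theorem IsVSDecomp.isInternal {F V ι : Type*} [Field F] [AddCommGroup V] [Module F V]
    [DecidableEq ι] {ℳ : ι → Submodule F V} (h : IsVSDecomp ℳ) : DirectSum.IsInternal ℳ := by
  classical
  constructor
  · rw [injective_iff_map_eq_zero]
    intro x hx
    have h1 : ∑ i ∈ DFinsupp.support x, (x i : V) = 0 := by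
      rw [← hx]
      exact (DirectSum.coeAddMonoidHom_eq_dfinsuppSum ℳ x).symm
    have h2 := h.2 (DFinsupp.support x) (fun i => (x i : V)) (fun i _ => (x i).2) h1
    ext i
    by_cases hi : i ∈ DFinsupp.support x
    · simpa using h2 i hi
    · have : x i = 0 := by simpa using hi
      simp [this]
  · intro v
    obtain ⟨t, c, hc, rfl⟩ := h.1 v
    have : ∑ i ∈ t, c i ∈ AddMonoidHom.range (DirectSum.coeAddMonoidHom ℳ) := by
      refine sum_mem fun i hi => ⟨DirectSum.of (fun i => ℳ i) i ⟨c i, hc i hi⟩, by simp⟩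
    exact this

/-- Uniqueness: if `∑ c i = 0`... with an element of one component. -/
theorem IsVSDecomp.disjoint {F V ι : Type*} [Field F] [AddCommGroup V] [Module F V]
    {ℳ : ι → Submodule F V} (h : IsVSDecomp ℳ) {i j : ι} (hij : i ≠ j) {v : V}
    (hi : v ∈ ℳ i) (hj : v ∈ ℳ j) : v = 0 := by
  classical
  have := h.2 {i, j} (fun k => if k = i then v else -v) (by
    intro k hk
    simp only [Finset.mem_insert, Finset.mem_singleton] at hk
    rcases hk with rfl | rfl
    · simpa using hi
    · simpa [hij.symm] using hj) (by
    rw [Finset.sum_pair hij]; simp [hij.symm]) i (by simp)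
  simpa using this

variable {F : Type*} [Field F] {G : Type*} [AddCommGroup G] {A : Type*} [Ring A] [Algebra F A]

/-- Every nonzero homogeneous element is invertible. -/
def HomInv (𝒟 : AlgebraGrading F G A) : Prop :=
  ∀ (g : G) (a : A), a ∈ 𝒟.comp g → a ≠ 0 → ∃ b ∈ 𝒟.comp (-g), a * b = 1 ∧ b * a = 1

/-- double centralizer graded subfield -/
def dcent (𝒟 : AlgebraGrading F G A) (hinv : HomInv 𝒟) (S : Set A)
    (hS : S ⊆ S.centralizer) : GradedSubfield 𝒟.comp where
  comp k := 𝒟.comp k ⊓ Subalgebra.toSubmodule (Subalgebra.centralizer F (S.centralizer))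
  le k := inf_le_left
  one_mem := ⟨𝒟.one_mem, Subalgebra.one_mem _⟩
  mul_mem := fun ha hb => ⟨𝒟.mul_mem ha.1 hb.1, Subalgebra.mul_mem _ ha.2 hb.2⟩
  comm := by
    intro g h a b ha hb
    have ha2 : a ∈ Set.centralizer (Set.centralizer S) := ha.2
    have hb2 : b ∈ Set.centralizer (Set.centralizer S) := hb.2
    have hb3 : b ∈ Set.centralizer S := Set.centralizer_subset hS hb2
    exact (ha2 b hb3).symm
  inv_mem := by
    intro g a ha h0
    obtain ⟨b, hb, h1, h2⟩ := hinv g a ha.1 h0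
    refine ⟨b, ⟨hb, ?_⟩, h1, h2⟩
    have ha2 : a ∈ Set.centralizer (Set.centralizer S) := ha.2
    show b ∈ Set.centralizer (Set.centralizer S)
    intro y hy
    have := ha2 y hy
    calc y * b = (b * a) * (y * b) := by rw [h2, one_mul]
      _ = b * (a * y) * b := by noncomm_ring
      _ = b * (y * a) * b := by rw [this]
      _ = b * y * (a * b) := by noncomm_ring
      _ = b * y := by rw [h1, mul_one]

theorem mem_dcent (𝒟 : AlgebraGrading F G A) (hinv : HomInv 𝒟) (S : Set A)
    (hS : S ⊆ S.centralizer) {k : G} {x : A} (hx : x ∈ 𝒟.comp k) (hxS : x ∈ S) :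
    x ∈ (dcent 𝒟 hinv S hS).comp k :=
  ⟨hx, Set.subset_centralizer_centralizer hxS⟩

/-- the homogeneous centralizer of a maximal graded subfield is itself -/
theorem mem_of_commute (𝒟 : AlgebraGrading F G A) (hinv : HomInv 𝒟)
    (𝒦 : GradedSubfield 𝒟.comp) (hmax : 𝒦.IsMaximal) {k : G} {x : A} (hx : x ∈ 𝒟.comp k)
    (hc : ∀ g, ∀ a ∈ 𝒦.comp g, a * x = x * a) : x ∈ 𝒦.comp k := by
  let S : Set A := insert x {a | ∃ g, a ∈ 𝒦.comp g}
  have hS : S ⊆ S.centralizer := by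
    rintro a (rfl | ⟨g, ha⟩) b (rfl | ⟨h, hb⟩)
    · rfl
    · exact hc h b hb
    · exact (hc g a ha).symm
    · exact 𝒦.comm hb ha
  rw [← hmax (dcent 𝒟 hinv S hS)
    (fun g a ha => mem_dcent 𝒟 hinv S hS (𝒦.le g ha) (Or.inr ⟨g, ha⟩)) k]
  exact mem_dcent 𝒟 hinv S hS hx (Or.inl rfl)

/-- support subgroup of a graded division algebra -/
def suppGrp [Nontrivial A] (𝒟 : AlgebraGrading F G A) (hinv : HomInv 𝒟) : AddSubgroup G where
  carrier := {g | ∃ a ∈ 𝒟.comp g, a ≠ 0}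
  zero_mem' := ⟨1, 𝒟.one_mem, one_ne_zero⟩
  add_mem' := by
    rintro g h ⟨a, ha, ha0⟩ ⟨b, hb, hb0⟩
    refine ⟨a * b, 𝒟.mul_mem ha hb, fun h0 => hb0 ?_⟩
    obtain ⟨c, -, -, h2⟩ := hinv g a ha ha0
    rw [← one_mul b, ← h2, mul_assoc, h0, mul_zero]
  neg_mem' := by
    rintro g ⟨a, ha, ha0⟩
    obtain ⟨c, hc, h1, h2⟩ := hinv g a ha ha0
    refine ⟨c, hc, ?_⟩
    rintro rfl
    simp at h1

/-- support of a graded subfield as a subgroup -/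
theorem exists_suppSub [Nontrivial A] (𝒟 : AlgebraGrading F G A) 
    (𝒦 : GradedSubfield 𝒟.comp) : ∃ H : AddSubgroup G, (H : Set G) = 𝒦.support := by
  refine ⟨{ carrier := 𝒦.support, zero_mem' := ?_, add_mem' := ?_, neg_mem' := ?_}, rfl⟩
  · intro g h hg hh
    obtain ⟨a, ha, ha0⟩ := (Submodule.ne_bot_iff _).1 hg
    obtain ⟨b, hb, hb0⟩ := (Submodule.ne_bot_iff _).1 hh
    refine (Submodule.ne_bot_iff _).2 ⟨a * b, 𝒦.mul_mem ha hb, fun h0 => hb0 ?_⟩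
    obtain ⟨c, -, -, h2⟩ := 𝒦.inv_mem ha ha0
    rw [← one_mul b, ← h2, mul_assoc, h0, mul_zero]
  · exact (Submodule.ne_bot_iff _).2 ⟨1, 𝒦.one_mem, one_ne_zero⟩
  · intro g hg
    obtain ⟨a, ha, ha0⟩ := (Submodule.ne_bot_iff _).1 hg
    obtain ⟨c, hc, h1, h2⟩ := 𝒦.inv_mem ha ha0
    refine (Submodule.ne_bot_iff _).2 ⟨c, hc, ?_⟩
    rintro rfl
    simp at h1

theorem comp_zero_of_finite [IsAlgClosed F] [Nontrivial A] [Module.Finite F A]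
    (𝒟 : AlgebraGrading F G A) (hinv : HomInv 𝒟) {x : A} (hx : x ∈ 𝒟.comp 0) :
    ∃ a : F, x = algebraMap F A a := by
  obtain ⟨a, ha⟩ := spectrum.nonempty_of_isAlgClosed_of_finiteDimensional F x
  refine ⟨a, ?_⟩
  by_contra hne
  have h0 : algebraMap F A a - x ≠ 0 := sub_ne_zero.2 (Ne.symm hne)
  have hm : algebraMap F A a - x ∈ 𝒟.comp 0 := by
    refine sub_mem ?_ hx
    rw [Algebra.algebraMap_eq_smul_one]
    exact Submodule.smul_mem _ _ 𝒟.one_mem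
  obtain ⟨b, -, h1, h2⟩ := hinv 0 _ hm h0
  exact ha ⟨⟨_, b, h1, h2⟩, rfl⟩

theorem comp_one_dim (𝒟 : AlgebraGrading F G A) (hinv : HomInv 𝒟)
    (h0 : ∀ x ∈ 𝒟.comp 0, ∃ a : F, x = algebraMap F A a) {g : G} {d x : A}
    (hd : d ∈ 𝒟.comp g) (hd0 : d ≠ 0) (hx : x ∈ 𝒟.comp g) : ∃ a : F, x = a • d := by
  obtain ⟨b, hb, h1, h2⟩ := hinv g d hd hd0
  obtain ⟨a, ha⟩ := h0 (x * b) (by simpa using 𝒟.mul_mem hx hb)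
  refine ⟨a, ?_⟩
  rw [Algebra.smul_def, ← ha, mul_assoc, h2, mul_one]

theorem exists_basis [Nontrivial A] (𝒟 : AlgebraGrading F G A) (hinv : HomInv 𝒟)
    (h0 : ∀ x ∈ 𝒟.comp 0, ∃ a : F, x = algebraMap F A a) :
    Nonempty (Module.Basis (suppGrp 𝒟 hinv) F A) := by
  classical
  have hc : ∀ t : suppGrp 𝒟 hinv, ∃ a ∈ 𝒟.comp t, a ≠ 0 := fun t => t.2
  choose c hc hc0 using hc
  refine ⟨Module.Basis.mk (v := c) ?_ ?_⟩
  · have hI := (𝒟.decomp.isInternal).submodule_iSupIndep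
    have := hI.comp (f := ((↑) : suppGrp 𝒟 hinv → G)) Subtype.val_injective
    exact this.linearIndependent _ (fun i => hc i) hc0
  · intro v _
    obtain ⟨t, f, hf, rfl⟩ := 𝒟.decomp.1 v
    refine sum_mem fun i hi => ?_
    by_cases hi0 : f i = 0
    · rw [hi0]; exact zero_mem _
    · let j : suppGrp 𝒟 hinv := ⟨i, f i, hf i hi, hi0⟩
      obtain ⟨a, ha⟩ := comp_one_dim 𝒟 hinv h0 (hc j) (hc0 j) (hf i hi)
      rw [ha]
      exact Submodule.smul_mem _ _ (Submodule.subset_span ⟨j, rfl⟩)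

/-- semisimplicity by the trace form -/
theorem semisimple_of_finite [IsAlgClosed F] [Nontrivial A] [Module.Finite F A]
    (𝒟 : AlgebraGrading F G A) (hinv : HomInv 𝒟)
    (hdim : ((Module.finrank F A : ℕ) : F) ≠ 0) : IsSemisimpleRing A := by
  classical
  have hArt : IsArtinianRing A := IsArtinianRing.of_finite F A
  rw [IsArtinianRing.isSemisimpleRing_iff_jacobson, eq_bot_iff]
  intro x hx
  rw [Submodule.mem_bot]
  obtain ⟨t, f, hf, hxs⟩ := 𝒟.decomp.1 x
  by_contra hx0
  have : ∃ i ∈ t, f i ≠ 0 := by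
    by_contra hcon
    push Not at hcon
    exact hx0 (hxs.trans (Finset.sum_eq_zero hcon))
  obtain ⟨i, hi, hi0⟩ := this
  obtain ⟨b, hb, h1, h2⟩ := hinv i (f i) (hf i hi) hi0
  have hbx : b * x ∈ Ring.jacobson A := Ideal.mul_mem_left _ _ hx
  have hnil : IsNilpotent (b * x) := by
    obtain ⟨n, hn⟩ := IsArtinianRing.isNilpotent_jacobson_bot (R := A)
    rw [Ideal.jacobson_bot] at hn
    refine ⟨n, ?_⟩
    have := Ideal.pow_mem_pow hbx n
    rw [hn] at this
    simpa using this
  have htr : LinearMap.trace F A (Algebra.lmul F A (b * x)) = 0 :=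
    (LinearMap.isNilpotent_trace_of_isNilpotent (hnil.map (Algebra.lmul F A))).eq_zero
  rw [hxs, Finset.mul_sum, map_sum, map_sum, Finset.sum_eq_single_of_mem i hi] at htr
  · rw [h2, map_one, LinearMap.trace_one] at htr
    exact hdim htr
  · intro j hj hji
    have hne : -i + j ≠ 0 := by
      intro h
      exact hji (neg_add_eq_zero.1 h).symm
    refine LinearMap.trace_eq_zero_of_mapsTo_ne 𝒟.decomp.isInternal (fun k => (-i + j) + k)
      (fun k => by simpa using hne) (fun k y hy => 𝒟.mul_mem (𝒟.mul_mem hb (hf j hj)) hy)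

end Helpers

section Helpers2

variable {F : Type*} [Field F] {G : Type*} [AddCommGroup G] {A : Type*} [Ring A] [Algebra F A]

theorem groupAlgebra_of_finite [IsAlgClosed F] [Nontrivial A] [Module.Finite F A]
    (𝒟 : AlgebraGrading F G A) (𝒦 : GradedSubfield 𝒟.comp) : 𝒦.IsGroupAlgebraOfSupport := by
  classical
  let S : Set A := {a | ∃ g, a ∈ 𝒦.comp g}
  have hcomm : ∀ a ∈ S, ∀ b ∈ S, a * b = b * a := by
    rintro a ⟨g, ha⟩ b ⟨h, hb⟩
    exact 𝒦.comm ha hb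
  let K := Algebra.adjoin F S
  have hKc := Algebra.isMulCommutative_adjoin F hcomm
  letI : CommRing K := { (inferInstance : Ring K) with mul_comm := fun a b => hKc.is_comm.comm a b }
  obtain ⟨M, hM⟩ := Ideal.exists_maximal K
  letI : Field (K ⧸ M) := Ideal.Quotient.field M
  haveI : Module.Finite F K := inferInstance
  haveI : Module.Finite F (K ⧸ M) := Module.Finite.of_surjective
    (Ideal.Quotient.mkₐ F M).toLinearMap (Ideal.Quotient.mkₐ_surjective F M)
  let ρ : K →ₐ[F] F := (IsAlgClosed.lift (R := F) (S := K ⧸ M) (M := F)).comp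
    (Ideal.Quotient.mkₐ F M)
  have hmem : ∀ {g : G} {a : A}, a ∈ 𝒦.comp g → a ∈ K := fun {g a} ha =>
    Algebra.subset_adjoin ⟨g, ha⟩
  have hρ : ∀ {g : G} {a : A} (ha : a ∈ 𝒦.comp g), ρ ⟨a, hmem ha⟩ = 0 → a = 0 := by
    intro g a ha h0
    by_contra hne
    obtain ⟨b, hb, h1, -⟩ := 𝒦.inv_mem ha hne
    have : (⟨a, hmem ha⟩ : K) * ⟨b, hmem hb⟩ = 1 := Subtype.ext h1
    have h2 := congrArg ρ this
    rw [map_mul, h0, zero_mul, map_one] at h2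
    exact zero_ne_one h2
  have hex : ∀ g ∈ 𝒦.support, ∃ a, ∃ ha : a ∈ 𝒦.comp g, ρ ⟨a, hmem ha⟩ = 1 := by
    intro g hg
    obtain ⟨a, ha, ha0⟩ := (Submodule.ne_bot_iff _).1 hg
    have hr : ρ ⟨a, hmem ha⟩ ≠ 0 := fun h => ha0 (hρ ha h)
    refine ⟨(ρ ⟨a, hmem ha⟩)⁻¹ • a, Submodule.smul_mem _ _ ha, ?_⟩
    have : (⟨(ρ ⟨a, hmem ha⟩)⁻¹ • a, hmem (Submodule.smul_mem _ _ ha)⟩ : K)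
      = (ρ ⟨a, hmem ha⟩)⁻¹ • ⟨a, hmem ha⟩ := rfl
    rw [this, map_smul, smul_eq_mul, inv_mul_cancel₀ hr]
  have huniq : ∀ {g : G} {a b : A} (ha : a ∈ 𝒦.comp g) (hb : b ∈ 𝒦.comp g),
      ρ ⟨a, hmem ha⟩ = ρ ⟨b, hmem hb⟩ → a = b := by
    intro g a b ha hb h
    refine sub_eq_zero.1 (hρ (sub_mem ha hb) ?_)
    have : (⟨a - b, hmem (sub_mem ha hb)⟩ : K) = ⟨a, hmem ha⟩ - ⟨b, hmem hb⟩ := rfl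
    rw [this, map_sub, h, sub_self]
  choose! c hc hc1 using hex
  obtain ⟨H, hH⟩ := exists_suppSub 𝒟 𝒦
  have hmemH : ∀ g, g ∈ 𝒦.support ↔ g ∈ H := fun g => by rw [← hH]; rfl
  have h0s : (0 : G) ∈ 𝒦.support := (hmemH 0).2 H.zero_mem
  refine ⟨c, ?_, ?_, ?_⟩
  · refine huniq (hc 0 h0s) 𝒦.one_mem ((hc1 0 h0s).trans ?_)
    exact (map_one ρ).symm
  · intro k hk
    refine ⟨hc k hk, ?_, le_antisymm ?_ ?_⟩
    · intro h0
      have := hc1 k hk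
      have h2 : (⟨c k, hmem (hc k hk)⟩ : K) = 0 := Subtype.ext h0
      rw [h2, map_zero] at this
      exact zero_ne_one this
    · intro y hy
      rw [Submodule.mem_span_singleton]
      refine ⟨ρ ⟨y, hmem hy⟩, huniq (Submodule.smul_mem _ _ (hc k hk)) hy ?_⟩
      have : (⟨ρ ⟨y, hmem hy⟩ • c k, hmem (Submodule.smul_mem _ _ (hc k hk))⟩ : K)
        = ρ ⟨y, hmem hy⟩ • ⟨c k, hmem (hc k hk)⟩ := rfl
      rw [this, map_smul, hc1 k hk, smul_eq_mul, mul_one]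
    · rw [Submodule.span_singleton_le_iff_mem]
      exact hc k hk
  · intro k₁ h1 k₂ h2
    have h12 : k₁ + k₂ ∈ 𝒦.support :=
      (hmemH _).2 (H.add_mem ((hmemH _).1 h1) ((hmemH _).1 h2))
    refine huniq (hc _ h12) (𝒦.mul_mem (hc _ h1) (hc _ h2)) ?_
    have : (⟨c k₁ * c k₂, hmem (𝒦.mul_mem (hc _ h1) (hc _ h2))⟩ : K)
      = ⟨c k₁, hmem (hc _ h1)⟩ * ⟨c k₂, hmem (hc _ h2)⟩ := rfl
    rw [this, map_mul, hc1 _ h1, hc1 _ h2, hc1 _ h12, mul_one]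

theorem support_subset [Nontrivial A] (𝒟 : AlgebraGrading F G A) (hinv : HomInv 𝒟)
    (𝒦 : GradedSubfield 𝒟.comp) : 𝒦.support ⊆ suppGrp 𝒟 hinv := by
  intro g hg
  obtain ⟨a, ha, ha0⟩ := (Submodule.ne_bot_iff _).1 hg
  exact ⟨a, 𝒦.le g ha, ha0⟩

theorem exists_maximal_subfield [IsAlgClosed F] [Nontrivial A] [Module.Finite F A]
    (𝒟 : AlgebraGrading F G A) (hinv : HomInv 𝒟) :
    ∃ 𝒦 : GradedSubfield 𝒟.comp, 𝒦.IsMaximal := by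
  classical
  have h0 : ∀ x ∈ 𝒟.comp 0, ∃ a : F, x = algebraMap F A a := fun x hx =>
    comp_zero_of_finite 𝒟 hinv hx
  obtain ⟨b⟩ := exists_basis 𝒟 hinv h0
  have hfin : Finite (suppGrp 𝒟 hinv) := Module.Finite.finite_basis b
  have hTf : ((suppGrp 𝒟 hinv : AddSubgroup G) : Set G).Finite := hfin
  let P : Set ℕ := {n | ∃ 𝒦 : GradedSubfield 𝒟.comp, 𝒦.support.ncard = n}
  have hPne : P.Nonempty := ⟨_, dcent 𝒟 hinv ∅ (by simp), rfl⟩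
  have hPb : BddAbove P := by
    refine ⟨((suppGrp 𝒟 hinv : AddSubgroup G) : Set G).ncard, ?_⟩
    rintro n ⟨𝒦, rfl⟩
    exact Set.ncard_le_ncard (support_subset 𝒟 hinv 𝒦) hTf
  obtain ⟨𝒦, h𝒦⟩ := Nat.sSup_mem hPne hPb
  refine ⟨𝒦, fun 𝒦' hle k => le_antisymm ?_ (hle k)⟩
  have hsub : 𝒦.support ⊆ 𝒦'.support := fun g hg h => hg (le_bot_iff.1 (h ▸ hle g))
  have heq : 𝒦.support = 𝒦'.support := by
    refine Set.eq_of_subset_of_ncard_le hsub ?_ (hTf.subset (support_subset 𝒟 hinv 𝒦'))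
    rw [h𝒦]
    exact le_csSup hPb ⟨𝒦', rfl⟩
  intro x hx
  by_cases hx0 : x = 0
  · rw [hx0]; exact zero_mem _
  have hk : k ∈ 𝒦.support := by
    rw [heq]
    exact (Submodule.ne_bot_iff _).2 ⟨x, hx, hx0⟩
  obtain ⟨d, hd, hd0⟩ := (Submodule.ne_bot_iff _).1 hk
  obtain ⟨a, rfl⟩ := comp_one_dim 𝒟 hinv h0 (𝒦.le k hd) hd0 (𝒦'.le k hx)
  exact Submodule.smul_mem _ _ hd

theorem two_imp_one [IsAlgClosed F] [Nontrivial A] [Module.Finite F A]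
    (𝒟 : AlgebraGrading F G A) (hinv : HomInv 𝒟)
    (hdim : ¬ (ringChar F ∣ Module.finrank F A)) :
    ∃ 𝒦 : GradedSubfield 𝒟.comp, 𝒦.IsMaximal ∧
        𝒦.IsGroupAlgebraOfSupport ∧ 𝒦.support.Finite ∧
        ¬ (ringChar F ∣ Nat.card ↥𝒦.support) := by
  obtain ⟨𝒦, hmax⟩ := exists_maximal_subfield 𝒟 hinv
  have h0 : ∀ x ∈ 𝒟.comp 0, ∃ a : F, x = algebraMap F A a := fun x hx =>
    comp_zero_of_finite 𝒟 hinv hx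
  obtain ⟨b⟩ := exists_basis 𝒟 hinv h0
  have hfin : Finite (suppGrp 𝒟 hinv) := Module.Finite.finite_basis b
  have hTf : ((suppGrp 𝒟 hinv : AddSubgroup G) : Set G).Finite := hfin
  refine ⟨𝒦, hmax, groupAlgebra_of_finite 𝒟 𝒦, hTf.subset (support_subset 𝒟 hinv 𝒦), ?_⟩
  intro hdvd
  apply hdim
  rw [Module.finrank_eq_nat_card_basis b]
  obtain ⟨H, hH⟩ := exists_suppSub 𝒟 𝒦
  have hle : H ≤ suppGrp 𝒟 hinv := by
    intro g hg
    apply support_subset 𝒟 hinv 𝒦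
    rw [← hH]; exact hg
  refine hdvd.trans ?_
  rw [← hH]
  exact AddSubgroup.card_dvd_of_le hle

theorem eq_of_mem_spectrum (𝒟 : AlgebraGrading F G A) (hinv : HomInv 𝒟) {x : A}
    (hx : x ∈ 𝒟.comp 0) {a : F} (ha : a ∈ spectrum F x) : x = algebraMap F A a := by
  by_contra hne
  have h0 : algebraMap F A a - x ≠ 0 := sub_ne_zero.2 (Ne.symm hne)
  have hm : algebraMap F A a - x ∈ 𝒟.comp 0 := by
    refine sub_mem ?_ hx
    rw [Algebra.algebraMap_eq_smul_one]
    exact Submodule.smul_mem _ _ 𝒟.one_mem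
  obtain ⟨b, -, h1, h2⟩ := hinv 0 _ hm h0
  exact ha ⟨⟨_, b, h1, h2⟩, rfl⟩

open Polynomial in
theorem scalar_of_pow [IsAlgClosed F] [Nontrivial A] (𝒟 : AlgebraGrading F G A)
    (hinv : HomInv 𝒟) {x : A}
    (hx : x ∈ 𝒟.comp 0) {n : ℕ} (hn : n ≠ 0) {l : F} (hl : x ^ n = algebraMap F A l) :
    ∃ a : F, x = algebraMap F A a := by
  let p : F[X] := X ^ n - C l
  have hp : p.Monic := monic_X_pow_sub_C l hn
  have hprod : (Multiset.map (fun x => X - C x) p.roots).prod = p :=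
    ((IsAlgClosed.splits p).eq_prod_roots_of_monic hp).symm
  have : ¬ IsUnit (aeval x (Multiset.map (fun x => X - C x) p.roots).prod) := by
    rw [hprod]
    simp [p, hl]
  obtain ⟨k, hk, -⟩ := spectrum.exists_mem_of_not_isUnit_aeval_prod this
  exact ⟨k, eq_of_mem_spectrum 𝒟 hinv hx hk⟩

theorem weight_avg {M : Type*} [CommGroup M] [Fintype M] (c : M →* A) (χ : M →* Fˣ) (x : A)
    (k : M) :
    c k * (∑ h : M, ((χ h)⁻¹ : Fˣ).val • (c h * x * c h⁻¹)) =
      (χ k).val • ((∑ h : M, ((χ h)⁻¹ : Fˣ).val • (c h * x * c h⁻¹)) * c k) := by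
  rw [Finset.mul_sum, Finset.sum_mul, Finset.smul_sum]
  refine Fintype.sum_equiv (Equiv.mulLeft k) _ _ fun h => ?_
  simp only [Equiv.coe_mulLeft, map_mul, mul_inv_rev, mul_smul_comm, smul_mul_assoc, smul_smul]
  congr 1
  · simp [mul_comm]
  · have h1 : c k⁻¹ * c k = 1 := by rw [← map_mul]; simp
    simp only [mul_assoc, h1, mul_one]

theorem sum_weight_avg {M : Type*} [CommGroup M] [Fintype M] [Fintype (M →* Fˣ)]
    [HasEnoughRootsOfUnity F (Monoid.exponent M)] (c : M →* A) (x : A) :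
    ∑ χ : M →* Fˣ, (∑ h : M, ((χ h)⁻¹ : Fˣ).val • (c h * x * c h⁻¹)) =
      (Fintype.card (M →* Fˣ) : F) • x := by
  classical
  rw [Finset.sum_comm]
  simp_rw [← Finset.sum_smul]
  rw [Finset.sum_eq_single_of_mem 1 (Finset.mem_univ _)]
  · simp
  · intro h _ hne
    obtain ⟨φ, hφ⟩ := CommGroup.exists_apply_ne_one_of_hasEnoughRootsOfUnity M F hne
    have key : ∑ χ : M →* Fˣ, ((χ h)⁻¹ : Fˣ).val = 0 := by
      let ev : (M →* Fˣ) →* F := (Units.coeHom F).comp (MonoidHom.eval h⁻¹)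
      have hev : ev ≠ 1 := by
        intro h1
        have := DFunLike.congr_fun h1 φ
        simp [ev] at this
        exact hφ this
      have := sum_hom_units_eq_zero ev hev
      simpa [ev] using this
    rw [key, zero_smul]

end Helpers2

section Helpers3

variable {F : Type*} [Field F] {G : Type*} [AddCommGroup G] {A : Type*} [Ring A] [Algebra F A]

theorem one_imp_two [IsAlgClosed F] [Nontrivial A]
    (𝒟 : AlgebraGrading F G A) (hinv : HomInv 𝒟)
    (𝒦 : GradedSubfield 𝒟.comp) (hmax : 𝒦.IsMaximal)
    (hga : 𝒦.IsGroupAlgebraOfSupport) (hfin : 𝒦.support.Finite)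
    (hcard : ¬ (ringChar F ∣ Nat.card ↥𝒦.support)) :
    Module.Finite F A ∧ ¬ (ringChar F ∣ Module.finrank F A) := by
  classical
  obtain ⟨H, hH⟩ := exists_suppSub 𝒟 𝒦
  have hmemH : ∀ g, g ∈ 𝒦.support ↔ g ∈ H := fun g => by rw [← hH]; rfl
  obtain ⟨c₀, hc0, hcs, hcm⟩ := hga
  rw [← hH] at hfin hcard
  have hHfin : Finite H := hfin
  have hMfin : Finite (Multiplicative H) := inferInstanceAs (Finite H)
  have : Fintype (Multiplicative H) := Fintype.ofFinite (Multiplicative H)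
  have hcM : ((Nat.card (Multiplicative H) : ℕ) : F) ≠ 0 := by
    intro h
    exact hcard ((ringChar.spec F _).1 h)
  have hexp : NeZero ((Monoid.exponent (Multiplicative H) : ℕ) : F) := by
    refine ⟨fun h => hcM ?_⟩
    obtain ⟨m, hm⟩ := Group.exponent_dvd_nat_card (G := (Multiplicative H))
    rw [hm, Nat.cast_mul, h, zero_mul]
  have hroots : HasEnoughRootsOfUnity F (Monoid.exponent (Multiplicative H)) := inferInstance
  have hdualcard : Nat.card ((Multiplicative H) →* Fˣ) = Nat.card (Multiplicative H) :=
    CommGroup.card_monoidHom_of_hasEnoughRootsOfUnity (Multiplicative H) F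
  have hdfin : Finite ((Multiplicative H) →* Fˣ) :=
    Finite.of_equiv (Multiplicative H) (CommGroup.monoidHom_mulEquiv_of_hasEnoughRootsOfUnity (Multiplicative H) F).some.symm.toEquiv
  have : Fintype ((Multiplicative H) →* Fˣ) := Fintype.ofFinite _
  let c : (Multiplicative H) →* A :=
    { toFun := fun h => c₀ (h.toAdd : G)
      map_one' := by simpa using hc0
      map_mul' := fun a b => by
        simpa using hcm _ ((hmemH _).2 a.toAdd.2) _ ((hmemH _).2 b.toAdd.2) }
  have hcK : ∀ h : (Multiplicative H), c h ∈ 𝒦.comp (h.toAdd : G) := fun h =>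
    (hcs _ ((hmemH _).2 h.toAdd.2)).1
  have hcD : ∀ h : (Multiplicative H), c h ∈ 𝒟.comp (h.toAdd : G) := fun h => 𝒦.le _ (hcK h)
  have hcinv : ∀ h : (Multiplicative H), c h⁻¹ * c h = 1 := fun h => by rw [← map_mul]; simp
  have hcinv' : ∀ h : (Multiplicative H), c h * c h⁻¹ = 1 := fun h => by rw [← map_mul]; simp
  -- commuting with all `c h` implies lying in `𝒦`
  have hcomm : ∀ {k : G} {x : A}, x ∈ 𝒟.comp k → (∀ h : (Multiplicative H), c h * x = x * c h) →
      x ∈ 𝒦.comp k := by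
    intro k x hx hc
    refine mem_of_commute 𝒟 hinv 𝒦 hmax hx fun g a ha => ?_
    by_cases ha0 : a = 0
    · simp [ha0]
    have hg : g ∈ 𝒦.support := (Submodule.ne_bot_iff _).2 ⟨a, ha, ha0⟩
    rw [(hcs g hg).2.2, Submodule.mem_span_singleton] at ha
    obtain ⟨r, rfl⟩ := ha
    have := hc (Multiplicative.ofAdd ⟨g, (hmemH g).1 hg⟩)
    have h2 : c₀ g * x = x * c₀ g := this
    rw [smul_mul_assoc, mul_smul_comm, h2]
  have hK0 : ∀ x ∈ 𝒦.comp 0, ∃ a : F, x = algebraMap F A a := by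
    intro x hx
    rw [(hcs 0 ((hmemH 0).2 H.zero_mem)).2.2, hc0, Submodule.mem_span_singleton] at hx
    obtain ⟨a, rfl⟩ := hx
    exact ⟨a, (Algebra.algebraMap_eq_smul_one a).symm⟩
  -- the identity component is `F`
  have h0 : ∀ x ∈ 𝒟.comp 0, ∃ a : F, x = algebraMap F A a := by
    intro x hx
    let y : ((Multiplicative H) →* Fˣ) → A := fun χ => ∑ h : (Multiplicative H), ((χ h)⁻¹ : Fˣ).val • (c h * x * c h⁻¹)
    have hy0 : ∀ χ, y χ ∈ 𝒟.comp 0 := by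
      intro χ
      refine sum_mem fun h _ => Submodule.smul_mem _ _ ?_
      have := 𝒟.mul_mem (𝒟.mul_mem (hcD h) hx) (hcD h⁻¹)
      simpa using this
    have hyw : ∀ χ k, c k * y χ = (χ k).val • (y χ * c k) := fun χ k => weight_avg c χ x k
    have hypow : ∀ χ k (n : ℕ), c k * y χ ^ n = ((χ k) ^ n).val • (y χ ^ n * c k) := by
      intro χ k n
      induction n with
      | zero => simp
      | succ n ih =>
        rw [pow_succ, ← mul_assoc, ih, smul_mul_assoc, mul_assoc, hyw, mul_smul_comm, smul_smul,
          pow_succ, Units.val_mul, mul_assoc]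
    have hyn0 : ∀ χ (n : ℕ), y χ ^ n ∈ 𝒟.comp 0 := by
      intro χ n
      induction n with
      | zero => simpa using 𝒟.one_mem
      | succ n ih =>
        rw [pow_succ]
        simpa using 𝒟.mul_mem ih (hy0 χ)
    have hyF : ∀ χ, ∃ a : F, y χ = algebraMap F A a := by
      intro χ
      have hk : y χ ^ (Nat.card (Multiplicative H)) ∈ 𝒦.comp 0 := by
        refine hcomm (hyn0 χ _) fun h => ?_
        rw [hypow, ← map_pow, pow_card_eq_one']
        simp
      obtain ⟨l, hl⟩ := hK0 _ hk
      exact scalar_of_pow 𝒟 hinv (hy0 χ) (Nat.card_pos.ne') hl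
    choose a ha using hyF
    have hsum : ∑ χ, y χ = (Fintype.card ((Multiplicative H) →* Fˣ) : F) • x := sum_weight_avg c x
    rw [← Nat.card_eq_fintype_card, hdualcard] at hsum
    refine ⟨((Nat.card (Multiplicative H) : ℕ) : F)⁻¹ * ∑ χ, a χ, ?_⟩
    rw [map_mul, map_sum, Finset.sum_congr rfl (fun χ _ => (ha χ).symm), hsum,
      ← Algebra.smul_def, smul_smul, inv_mul_cancel₀ hcM, one_smul]
  obtain ⟨b⟩ := exists_basis 𝒟 hinv h0
  -- the commutation characters
  let T := suppGrp 𝒟 hinv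
  have hd : ∀ t : T, ∃ a ∈ 𝒟.comp t, a ≠ 0 := fun t => t.2
  choose d hdm hd0 using hd
  have hχ : ∀ (t : T) (h : (Multiplicative H)), ∃ r : F, ∀ x ∈ 𝒟.comp (t : G), c h * x = r • (x * c h) := by
    intro t h
    have hm : c h * d t * c h⁻¹ ∈ 𝒟.comp (t : G) := by
      have := 𝒟.mul_mem (𝒟.mul_mem (hcD h) (hdm t)) (hcD h⁻¹)
      simpa using this
    obtain ⟨r, hr⟩ := comp_one_dim 𝒟 hinv h0 (hdm t) (hd0 t) hm
    refine ⟨r, fun x hx => ?_⟩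
    obtain ⟨s, rfl⟩ := comp_one_dim 𝒟 hinv h0 (hdm t) (hd0 t) hx
    have : c h * d t = r • (d t * c h) := by
      rw [← smul_mul_assoc, ← hr, mul_assoc, hcinv, mul_one]
    rw [mul_smul_comm, this, smul_mul_assoc, smul_comm]
  choose χ hχ using hχ
  have hne : ∀ (t : T) (h : (Multiplicative H)) (x : A), x ≠ 0 → x * c h ≠ 0 := by
    intro t h x hx h0
    apply hx
    rw [← mul_one x, ← hcinv' h, ← mul_assoc, h0, zero_mul]
  have hχu : ∀ (t : T) (h : (Multiplicative H)) (r : F) (x : A), x ∈ 𝒟.comp (t : G) → x ≠ 0 →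
      c h * x = r • (x * c h) → χ t h = r := by
    intro t h r x hx hx0 hr
    rw [hχ t h x hx] at hr
    exact smul_left_injective F (hne t h x hx0) hr
  let Χ : T → ((Multiplicative H) →* F) := fun t =>
    { toFun := χ t
      map_one' := hχu t 1 1 (d t) (hdm t) (hd0 t) (by simp)
      map_mul' := fun h k => by
        refine hχu t _ _ (d t) (hdm t) (hd0 t) ?_
        rw [map_mul, mul_assoc, hχ t k _ (hdm t), mul_smul_comm, ← mul_assoc, hχ t h _ (hdm t),
          smul_mul_assoc, smul_smul, mul_assoc, mul_comm (χ t k)] }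
  let Φ : Multiplicative T →* ((Multiplicative H) →* Fˣ) := MonoidHom.mk' (fun t => (Χ t.toAdd).toHomUnits) (by
    intro s t
    ext h
    show χ (s * t).toAdd h = χ s.toAdd h * χ t.toAdd h
    have hprod : d s.toAdd * d t.toAdd ∈ 𝒟.comp ((s * t).toAdd : T) :=
      𝒟.mul_mem (hdm _) (hdm _)
    refine hχu _ _ _ _ hprod ?_ ?_
    · intro hz
      obtain ⟨e, -, -, h2⟩ := hinv _ _ (hdm s.toAdd) (hd0 s.toAdd)
      apply hd0 t.toAdd
      rw [← one_mul (d t.toAdd), ← h2, mul_assoc, hz, mul_zero]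
    · show _ = (χ s.toAdd h * χ t.toAdd h) • _
      rw [← mul_assoc, hχ _ h _ (hdm s.toAdd), smul_mul_assoc, mul_assoc, hχ _ h _ (hdm t.toAdd),
        mul_smul_comm, smul_smul, mul_assoc])
  have hker : ∀ t : Multiplicative T, t ∈ Φ.ker ↔ ((t.toAdd : T) : G) ∈ H := by
    intro t
    rw [MonoidHom.mem_ker]
    constructor
    · intro h1
      rw [← hmemH]
      refine (Submodule.ne_bot_iff _).2 ⟨d t.toAdd, hcomm (hdm _) fun h => ?_, hd0 _⟩
      have h2 := congrArg Units.val (DFunLike.congr_fun h1 h)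
      have h3 : χ t.toAdd h = 1 := h2
      rw [hχ _ h _ (hdm _), h3, one_smul]
    · intro ht
      ext h
      show χ t.toAdd h = 1
      have hk := hcs _ ((hmemH _).2 ht)
      refine hχu _ h 1 _ (𝒦.le _ hk.1) hk.2.1 ?_
      rw [one_smul]
      exact 𝒦.comm (hcK h) hk.1
  have hcardker : Nat.card Φ.ker = Nat.card (Multiplicative H) := by
    refine Nat.card_congr
      { toFun := fun t => Multiplicative.ofAdd ⟨_, (hker t.1).1 t.2⟩
        invFun := fun h => ⟨Multiplicative.ofAdd ⟨(h.toAdd : G),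
          support_subset 𝒟 hinv 𝒦 ((hmemH _).2 h.toAdd.2)⟩, (hker _).2 h.toAdd.2⟩
        left_inv := fun t => rfl
        right_inv := fun h => rfl }
  have hcardT : Nat.card (Multiplicative H) * Nat.card Φ.range = Nat.card T := by
    rw [← hcardker, ← Subgroup.index_ker, Subgroup.card_mul_index]
    rfl
  have hcT : ((Nat.card T : ℕ) : F) ≠ 0 := by
    rw [← hcardT, Nat.cast_mul]
    refine mul_ne_zero hcM fun h => hcM ?_
    obtain ⟨m, hm⟩ := Subgroup.card_subgroup_dvd_card Φ.range
    rw [← hdualcard, hm, Nat.cast_mul, h, zero_mul]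
  have hTfin : Finite T := by
    refine Nat.finite_of_card_ne_zero fun h => hcT ?_
    rw [h, Nat.cast_zero]
  refine ⟨Module.Finite.of_basis b, fun h => hcT ?_⟩
  rw [Module.finrank_eq_nat_card_basis b] at h
  exact (ringChar.spec F _).2 h

end Helpers3

section Helpers4

variable {F : Type*} [Field F] {G : Type*} [AddCommGroup G]
    {R : Type*} [Ring R] [Algebra F R]
    {W : Type*} [AddCommGroup W] [Module F W] [Module R W] [IsScalarTower F R W]
    [SMulCommClass R F W]
    {𝒜 : AlgebraGrading F G R} (𝒲 : ModuleGrading 𝒜 (AddMonoidHom.id G) W)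

theorem exists_factor {R M N P : Type*} [Ring R] [AddCommGroup M] [AddCommGroup N] [AddCommGroup P]
    [Module R M] [Module R N] [Module R P] (p : M →ₗ[R] N) (q : M →ₗ[R] P)
    (hp : Function.Surjective p) (h : ∀ m, p m = 0 → q m = 0) :
    ∃ f : N →ₗ[R] P, ∀ m, f (p m) = q m := by
  refine ⟨((LinearMap.ker p).liftQ q (fun m hm => h m hm)).comp
    (p.quotKerEquivOfSurjective hp).symm.toLinearMap, fun m => ?_⟩
  have : (p.quotKerEquivOfSurjective hp).symm (p m) = (LinearMap.ker p).mkQ m := by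
    rw [LinearEquiv.symm_apply_eq]; rfl
  rw [LinearMap.comp_apply, LinearEquiv.coe_coe, this]
  rfl

theorem smul_mem' {g k : G} {r : R} {v : W} (hr : r ∈ 𝒜.comp g) (hv : v ∈ 𝒲.comp k) :
    r • v ∈ 𝒲.comp (g + k) := 𝒲.smul_mem hr hv

/-- If `r` (homogeneous) kills a finite sum of homogeneous elements, it kills each of them. -/
theorem smul_comp_zero {g : G} {r : R} (hr : r ∈ 𝒜.comp g) (t : Finset G) (u : G → W)
    (hu : ∀ i ∈ t, u i ∈ 𝒲.comp i) (h : r • ∑ i ∈ t, u i = 0) : ∀ i ∈ t, r • u i = 0 := by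
  classical
  intro i hi
  rw [Finset.smul_sum] at h
  have h2 : ∑ j ∈ t.map (Equiv.addLeft g).toEmbedding, r • u (-g + j) = 0 := by
    rw [Finset.sum_map]
    simpa using h
  have := 𝒲.decomp.2 _ (fun j => r • u (-g + j)) (by
    intro j hj
    rw [Finset.mem_map] at hj
    obtain ⟨k, hk, rfl⟩ := hj
    have := smul_mem' 𝒲 hr (hu k hk)
    simpa using this) h2 (g + i) (Finset.mem_map.2 ⟨i, hi, rfl⟩)
  simpa using this

/-- If `(∑ r_i) w = 0` with `w` homogeneous then each `r_i w = 0`. -/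
theorem comp_smul_zero {k : G} {w : W} (hw : w ∈ 𝒲.comp k) (t : Finset G) (r : G → R)
    (hr : ∀ i ∈ t, r i ∈ 𝒜.comp i) (h : (∑ i ∈ t, r i) • w = 0) : ∀ i ∈ t, r i • w = 0 := by
  classical
  intro i hi
  rw [Finset.sum_smul] at h
  have h2 : ∑ j ∈ t.map (Equiv.addRight k).toEmbedding, r (j - k) • w = 0 := by
    rw [Finset.sum_map]
    simpa using h
  have := 𝒲.decomp.2 _ (fun j => r (j - k) • w) (by
    intro j hj
    rw [Finset.mem_map] at hj
    obtain ⟨l, hl, rfl⟩ := hj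
    have := smul_mem' 𝒲 (hr l hl) hw
    simpa using this) h2 (i + k) (Finset.mem_map.2 ⟨i, hi, rfl⟩)
  simpa using this

/-- A graded left ideal (all homogeneous components stay inside) times a homogeneous vector
is a graded submodule. -/
theorem graded_image {k : G} {w : W} (hw : w ∈ 𝒲.comp k) (L : Submodule R R)
    (hL : ∀ (t : Finset G) (r : G → R), (∀ i ∈ t, r i ∈ 𝒜.comp i) → ∑ i ∈ t, r i ∈ L →
      ∀ i ∈ t, r i ∈ L) :
    IsGradedSubmodule 𝒲.comp (L.map (LinearMap.toSpanSingleton R W w)) := by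
  classical
  rintro _ ⟨l, hl, rfl⟩
  obtain ⟨t, r, hr, rfl⟩ := 𝒜.decomp.1 l
  refine ⟨t.map (Equiv.addRight k).toEmbedding, fun j => r (j - k) • w, ?_, ?_⟩
  · intro j hj
    rw [Finset.mem_map] at hj
    obtain ⟨i, hi, rfl⟩ := hj
    have h1 := smul_mem' 𝒲 (hr i hi) hw
    refine ⟨by simpa using h1, r i, hL t r hr hl i hi, by simp⟩
  · rw [Finset.sum_map]
    simp [Finset.sum_smul]


theorem IsVSDecomp.indep_shift {V ι : Type*} [AddCommGroup V] [Module F V]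
    {ℳ : ι → Submodule F V} (h : IsVSDecomp ℳ) (σ : ι ≃ ι) (t : Finset ι) (c : ι → V)
    (hc : ∀ i ∈ t, c i ∈ ℳ (σ i)) (h0 : ∑ i ∈ t, c i = 0) : ∀ i ∈ t, c i = 0 := by
  intro i hi
  have := h.2 (t.map σ.toEmbedding) (fun j => c (σ.symm j)) (by
    intro j hj
    rw [Finset.mem_map] at hj
    obtain ⟨k, hk, rfl⟩ := hj
    simpa using hc k hk) (by rw [Finset.sum_map]; simpa using h0) (σ i)
    (Finset.mem_map.2 ⟨i, hi, rfl⟩)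
  simpa using this

theorem IsVSDecomp.single {V ι : Type*} [AddCommGroup V] [Module F V]
    {ℳ : ι → Submodule F V} (h : IsVSDecomp ℳ) (σ : ι ≃ ι) (t : Finset ι) (c : ι → V)
    (hc : ∀ i ∈ t, c i ∈ ℳ (σ i)) {l : ι} (hl : ∑ i ∈ t, c i ∈ ℳ l) :
    ∀ i ∈ t, σ i ≠ l → c i = 0 := by
  classical
  intro i hi hil
  have := h.indep_shift σ (insert (σ.symm l) t)
    (fun j => (if j ∈ t then c j else 0) - if j = σ.symm l then ∑ i ∈ t, c i else 0) (by
      intro j hj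
      refine sub_mem ?_ ?_
      · split_ifs with hjt
        · exact hc j hjt
        · exact zero_mem _
      · split_ifs with hjl
        · rw [hjl]; simpa using hl
        · exact zero_mem _) (by
      rw [Finset.sum_sub_distrib, sub_eq_zero, Finset.sum_ite_eq' (insert (σ.symm l) t),
        if_pos (Finset.mem_insert_self _ _), Finset.sum_ite_mem,
        Finset.inter_eq_right.2 (Finset.subset_insert _ _)]) i (Finset.mem_insert_of_mem hi)
  have hne : i ≠ σ.symm l := fun h => hil (by rw [h]; simp)
  simpa [hi, hne] using this

variable {𝒲}

theorem image_eq_top (hs : IsGradedSimpleModule R 𝒲.comp) {k : G} {w : W} (hw : w ∈ 𝒲.comp k)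
    (L : Submodule R R)
    (hL : ∀ (t : Finset G) (r : G → R), (∀ i ∈ t, r i ∈ 𝒜.comp i) → ∑ i ∈ t, r i ∈ L →
      ∀ i ∈ t, r i ∈ L) (hne : ∃ l ∈ L, l • w ≠ 0) (v : W) : ∃ l ∈ L, l • w = v := by
  rcases hs.2 _ (graded_image 𝒲 hw L hL) with h | h
  · obtain ⟨l, hl, h0⟩ := hne
    exfalso
    apply h0
    have : LinearMap.toSpanSingleton R W w l ∈ L.map (LinearMap.toSpanSingleton R W w) :=
      ⟨l, hl, rfl⟩
    rw [h] at this
    simpa using this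
  · have : v ∈ L.map (LinearMap.toSpanSingleton R W w) := by rw [h]; trivial
    obtain ⟨l, hl, rfl⟩ := this
    exact ⟨l, hl, rfl⟩

theorem cyclic (hs : IsGradedSimpleModule R 𝒲.comp) {k : G} {w : W} (hw : w ∈ 𝒲.comp k)
    (hw0 : w ≠ 0) (v : W) : ∃ r : R, r • w = v := by
  obtain ⟨l, -, h⟩ := image_eq_top hs hw ⊤ (fun _ _ _ _ _ _ => trivial)
    ⟨1, trivial, by simpa using hw0⟩ v
  exact ⟨l, h⟩

theorem exists_homog (hs : IsGradedSimpleModule R 𝒲.comp) :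
    ∃ (k : G) (w : W), w ∈ 𝒲.comp k ∧ w ≠ 0 := by
  obtain ⟨v, hv⟩ := hs.1
  obtain ⟨t, c, hc, rfl⟩ := 𝒲.decomp.1 v
  by_contra hcon
  push Not at hcon
  exact hv (Finset.sum_eq_zero fun i hi => hcon i _ (hc i hi))

theorem exists_hom (hs : IsGradedSimpleModule R 𝒲.comp) {g k : G} {w u : W}
    (hw : w ∈ 𝒲.comp g) (hw0 : w ≠ 0) (hu : u ∈ 𝒲.comp k)
    (h : ∀ (i : G) (r : R), r ∈ 𝒜.comp i → r • w = 0 → r • u = 0) :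
    ∃ f : Module.End R W, f ∈ homogComp (F := F) 𝒲.comp (k - g) ∧ f w = u := by
  obtain ⟨f, hf⟩ := exists_factor (LinearMap.toSpanSingleton R W w)
    (LinearMap.toSpanSingleton R W u) (fun v => cyclic hs hw hw0 v) (by
      intro r hr
      obtain ⟨t, c, hc, rfl⟩ := 𝒜.decomp.1 r
      have h1 := comp_smul_zero 𝒲 hw t c hc hr
      show (∑ i ∈ t, c i) • u = 0
      rw [Finset.sum_smul]
      exact Finset.sum_eq_zero fun i hi => h i _ (hc i hi) (h1 i hi))
  simp only [LinearMap.toSpanSingleton_apply] at hf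
  refine ⟨f, ?_, by simpa using hf 1⟩
  intro l v hv
  obtain ⟨r, rfl⟩ := cyclic hs hw hw0 v
  obtain ⟨t, c, hc, rfl⟩ := 𝒜.decomp.1 r
  rw [hf, Finset.sum_smul]
  rw [Finset.sum_smul] at hv
  have h1 := 𝒲.decomp.single (Equiv.addRight g) t (fun i => c i • w)
    (fun i hi => smul_mem' 𝒲 (hc i hi) hw) hv
  refine sum_mem fun i hi => ?_
  by_cases hil : i + g = l
  · have := smul_mem' 𝒲 (hc i hi) hu
    rw [← hil]
    convert this using 1
    congr 1
    abel
  · rw [h i _ (hc i hi) (h1 i hi hil)]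
    exact zero_mem _

theorem end_ext (hs : IsGradedSimpleModule R 𝒲.comp) {k : G} {w : W} (hw : w ∈ 𝒲.comp k)
    (hw0 : w ≠ 0) {f f' : Module.End R W} (h : f w = f' w) : f = f' := by
  ext v
  obtain ⟨r, rfl⟩ := cyclic hs hw hw0 v
  rw [map_smul, map_smul, h]

theorem end_decomp (hs : IsGradedSimpleModule R 𝒲.comp) :
    IsVSDecomp (homogComp (F := F) (R := R) 𝒲.comp) := by
  obtain ⟨g, w, hw, hw0⟩ := exists_homog hs
  constructor
  · intro f
    obtain ⟨t, u, hu, hfu⟩ := 𝒲.decomp.1 (f w)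
    have : ∀ k ∈ t, ∃ fk : Module.End R W,
        fk ∈ homogComp (F := F) 𝒲.comp (k - g) ∧ fk w = u k := by
      intro k hk
      refine exists_hom hs hw hw0 (hu k hk) fun i r hr h0 => ?_
      refine smul_comp_zero 𝒲 hr t u hu ?_ k hk
      rw [← hfu, ← map_smul, h0, map_zero]
    choose! c hc hcw using this
    refine ⟨t.map (Equiv.addRight (-g)).toEmbedding, fun d => c (d + g), ?_, ?_⟩
    · intro d hd
      rw [Finset.mem_map] at hd
      obtain ⟨k, hk, rfl⟩ := hd
      simpa [sub_eq_add_neg] using hc k hk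
    · refine end_ext hs hw hw0 ?_
      rw [Finset.sum_map, hfu, LinearMap.sum_apply]
      refine Finset.sum_congr rfl fun k hk => ?_
      simpa using (hcw k hk).symm
  · intro t c hc h0 d hd
    refine end_ext hs hw hw0 ?_
    refine 𝒲.decomp.indep_shift (Equiv.addLeft g) t (fun d => c d w)
      (fun i hi => hc i hi hw) ?_ d hd
    rw [← LinearMap.sum_apply, h0, LinearMap.zero_apply]

/-- the grading of the centralizer -/
def endGrading (hs : IsGradedSimpleModule R 𝒲.comp) : AlgebraGrading F G (Module.End R W) where
  comp := homogComp 𝒲.comp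
  decomp := end_decomp hs
  one_mem := fun k v hv => by simpa using hv
  mul_mem := fun {g h r s} hr hs' k v hv => by
    have := hr (hs' hv)
    rw [add_assoc, add_comm h g] at this
    exact this

theorem end_homInv (hs : IsGradedSimpleModule R 𝒲.comp) : HomInv (endGrading (F := F) hs) := by
  intro d f hf hf0
  have hf : IsHomogeneousEnd 𝒲.comp d f := hf
  have hinj : LinearMap.ker f = ⊥ := by
    refine (hs.2 (LinearMap.ker f) ?_).resolve_right fun h => hf0 (LinearMap.ker_eq_top.1 h)
    intro v hv
    obtain ⟨t, c, hc, rfl⟩ := 𝒲.decomp.1 v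
    rw [LinearMap.mem_ker, map_sum] at hv
    have := 𝒲.decomp.indep_shift (Equiv.addRight d) t (fun i => f (c i))
      (fun i hi => hf (hc i hi)) hv
    exact ⟨t, c, fun i hi => ⟨hc i hi, this i hi⟩, rfl⟩
  have hsurj : LinearMap.range f = ⊤ := by
    refine (hs.2 (LinearMap.range f) ?_).resolve_left fun h => hf0 (LinearMap.range_eq_bot.1 h)
    rintro _ ⟨v, rfl⟩
    obtain ⟨t, c, hc, rfl⟩ := 𝒲.decomp.1 v
    refine ⟨t.map (Equiv.addRight d).toEmbedding, fun j => f (c (j - d)), ?_, ?_⟩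
    · intro j hj
      rw [Finset.mem_map] at hj
      obtain ⟨i, hi, rfl⟩ := hj
      simpa using hf (hc i hi)
    · rw [Finset.sum_map]
      simp
  let e : W ≃ₗ[R] W := LinearEquiv.ofBijective f
    ⟨LinearMap.ker_eq_bot.1 hinj, LinearMap.range_eq_top.1 hsurj⟩
  have hfe : ∀ v, f v = e v := fun v => rfl
  refine ⟨e.symm.toLinearMap, ?_, ?_, ?_⟩
  · intro k v hv
    obtain ⟨u, rfl⟩ := e.surjective v
    obtain ⟨t, c, hc, rfl⟩ := 𝒲.decomp.1 u
    rw [← hfe, map_sum] at hv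
    have := 𝒲.decomp.single (Equiv.addRight d) t (fun i => f (c i))
      (fun i hi => hf (hc i hi)) hv
    show e.symm (e _) ∈ _
    rw [e.symm_apply_apply]
    refine sum_mem fun i hi => ?_
    by_cases hik : i + d = k
    · rw [← hik]
      simpa using hc i hi
    · have h0 := this i hi hik
      have : c i = 0 := LinearMap.ker_eq_bot.1 hinj (by simpa using h0)
      rw [this]; exact zero_mem _
  · ext v
    exact e.apply_symm_apply v
  · ext v
    exact e.symm_apply_apply v

/-- left annihilator of a finite set -/
def annL (R : Type*) {W : Type*} [Ring R] [AddCommGroup W] [Module R W] (s : Finset W) :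
    Submodule R R where
  carrier := {r | ∀ w ∈ s, r • w = 0}
  add_mem' := fun ha hb w hw => by rw [add_smul, ha w hw, hb w hw, add_zero]
  zero_mem' := fun w _ => zero_smul _ _
  smul_mem' := fun a r hr w hw => by rw [smul_eq_mul, mul_smul, hr w hw, smul_zero]

theorem annL_graded (s : Finset W) (hsm : ∀ w ∈ s, ∃ k, w ∈ 𝒲.comp k)
    (t : Finset G) (r : G → R) (hr : ∀ i ∈ t, r i ∈ 𝒜.comp i) (h : ∑ i ∈ t, r i ∈ annL R s) :
    ∀ i ∈ t, r i ∈ annL R s := by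
  intro i hi w hw
  obtain ⟨k, hk⟩ := hsm w hw
  exact comp_smul_zero 𝒲 hk t r hr (h w hw) i hi

theorem density (hs : IsGradedSimpleModule R 𝒲.comp) (s : Finset W)
    (hsm : ∀ w ∈ s, ∃ k, w ∈ 𝒲.comp k) :
    ∀ x : W, (∀ r ∈ annL R s, r • x = 0) →
      x ∈ Submodule.span (Module.End R W) (s : Set W) := by
  classical
  induction s using Finset.induction_on with
  | empty =>
    intro x hx
    have := hx 1 (fun w hw => by simp at hw)
    rw [one_smul] at this
    rw [this]; exact zero_mem _
  | insert w s hws ih =>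
    intro x hx
    have hsm' : ∀ w ∈ s, ∃ k, w ∈ 𝒲.comp k := fun v hv => hsm v (Finset.mem_insert_of_mem hv)
    obtain ⟨k, hwk⟩ := hsm w (Finset.mem_insert_self _ _)
    have hle : Submodule.span (Module.End R W) (s : Set W) ≤
        Submodule.span (Module.End R W) ((insert w s : Finset W) : Set W) :=
      Submodule.span_mono (by simp)
    by_cases hk : ∃ l ∈ annL R s, l • w ≠ 0
    · have htop := image_eq_top hs hwk (annL R s) (annL_graded s hsm') hk
      obtain ⟨f, hf⟩ := exists_factor
        ((LinearMap.toSpanSingleton R W w).comp (annL R s).subtype)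
        ((LinearMap.toSpanSingleton R W x).comp (annL R s).subtype)
        (fun v => by
          obtain ⟨l, hl, h⟩ := htop v
          exact ⟨⟨l, hl⟩, h⟩)
        (by
          rintro ⟨l, hl⟩ h0
          refine hx l fun v hv => ?_
          rcases Finset.mem_insert.1 hv with rfl | hv
          · exact h0
          · exact hl v hv)
      have hf' : ∀ l ∈ annL R s, f (l • w) = l • x := fun l hl => hf ⟨l, hl⟩
      have h1 : x - f w ∈ Submodule.span (Module.End R W) (s : Set W) := by
        refine ih hsm' _ fun l hl => ?_
        rw [smul_sub, ← hf' l hl, map_smul, sub_self]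
      have h2 : (f : Module.End R W) • w ∈
          Submodule.span (Module.End R W) ((insert w s : Finset W) : Set W) :=
        Submodule.smul_mem _ _ (Submodule.subset_span (by simp))
      have := add_mem (hle h1) h2
      rwa [Module.End.smul_def, sub_add_cancel] at this
    · push Not at hk
      refine hle (ih hsm' x fun l hl => hx l fun v hv => ?_)
      rcases Finset.mem_insert.1 hv with rfl | hv
      · exact hk l hl
      · exact hl v hv

theorem annL_smul_span (s : Finset W) {l : R} (hl : l ∈ annL R s) {z : W}
    (hz : z ∈ Submodule.span (Module.End R W) (s : Set W)) : l • z = 0 := by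
  induction hz using Submodule.span_induction with
  | mem x hx => exact hl x hx
  | zero => exact smul_zero _
  | add x y _ _ hx hy => rw [smul_add, hx, hy, add_zero]
  | smul a x _ hx => rw [Module.End.smul_def, ← map_smul, hx, map_zero]

theorem exists_range_le_aux (hs : IsGradedSimpleModule R 𝒲.comp) (s : Finset W)
    (hsm : ∀ w ∈ s, ∃ k, w ∈ 𝒲.comp k) :
    ∀ x ∈ Submodule.span (Module.End R W) (s : Set W), x ≠ 0 →
      ∃ d : Module.End R W, d ≠ 0 ∧ LinearMap.range d ≤ Submodule.span R {x} := by
  classical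
  induction s using Finset.induction_on with
  | empty =>
    intro x hx hx0
    simp at hx
    exact absurd hx hx0
  | insert w s hws ih =>
    intro x hx hx0
    have hsm' : ∀ w ∈ s, ∃ k, w ∈ 𝒲.comp k := fun v hv => hsm v (Finset.mem_insert_of_mem hv)
    obtain ⟨k, hwk⟩ := hsm w (Finset.mem_insert_self _ _)
    rw [Finset.coe_insert, Submodule.mem_span_insert] at hx
    obtain ⟨f, z, hz, rfl⟩ := hx
    by_cases hk : ∃ l ∈ annL R s, l • w ≠ 0
    · have htop := image_eq_top hs hwk (annL R s) (annL_graded s hsm') hk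
      by_cases hf0 : f = 0
      · refine ih hsm' _ ?_ hx0
        simpa [hf0] using hz
      · refine ⟨f, hf0, ?_⟩
        rintro _ ⟨v, rfl⟩
        obtain ⟨l, hl, rfl⟩ := htop v
        rw [Submodule.mem_span_singleton]
        refine ⟨l, ?_⟩
        rw [smul_add, annL_smul_span s hl hz, add_zero, Module.End.smul_def, map_smul]
    · push Not at hk
      refine ih hsm' _ (add_mem (Submodule.smul_mem _ _ (density hs s hsm' w hk)) hz) hx0

theorem exists_range_le (hs : IsGradedSimpleModule R 𝒲.comp) (N : Submodule R W) (hN : N ≠ ⊥) :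
    ∃ d : Module.End R W, d ≠ 0 ∧ LinearMap.range d ≤ N := by
  classical
  obtain ⟨x, hx, hx0⟩ := (Submodule.ne_bot_iff _).1 hN
  obtain ⟨t, c, hc, hxs⟩ := 𝒲.decomp.1 x
  obtain ⟨d, hd, hle⟩ := exists_range_le_aux hs (t.image c) (by
    intro w hw
    obtain ⟨i, hi, rfl⟩ := Finset.mem_image.1 hw
    exact ⟨i, hc i hi⟩) x (by
    rw [hxs]
    exact sum_mem fun i hi => Submodule.subset_span (Finset.mem_image_of_mem c hi)) hx0
  exact ⟨d, hd, hle.trans (by simpa using hx)⟩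

theorem semisimple_of_end (hs : IsGradedSimpleModule R 𝒲.comp)
    (hD : IsSemisimpleRing (Module.End R W)) : IsSemisimpleModule R W := by
  have hDop : IsSemisimpleRing (Module.End R W)ᵐᵒᵖ := inferInstance
  rw [isSemisimpleModule_iff]
  refine ⟨fun N => ?_⟩
  let I : Submodule (Module.End R W)ᵐᵒᵖ (Module.End R W)ᵐᵒᵖ :=
    { carrier := {a | ∀ v, a.unop v ∈ N}
      add_mem' := fun ha hb v => N.add_mem (ha v) (hb v)
      zero_mem' := fun v => N.zero_mem
      smul_mem' := fun a b hb v => hb (a.unop v) }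
  obtain ⟨J, hJ⟩ := exists_isCompl I
  have h1 : (1 : (Module.End R W)ᵐᵒᵖ) ∈ I ⊔ J := by rw [hJ.sup_eq_top]; trivial
  obtain ⟨e, he, f, hf, hef⟩ := Submodule.mem_sup.1 h1
  have key : ∀ d : Module.End R W, (∀ v, d v ∈ N) → e.unop * d = d := by
    intro d hd
    have hdI : MulOpposite.op d ∈ I := hd
    have h2 : MulOpposite.op d = MulOpposite.op d * e + MulOpposite.op d * f := by
      rw [← mul_add, hef, mul_one]
    have h3 : MulOpposite.op d * f ∈ I := by
      have : MulOpposite.op d * f = MulOpposite.op d - MulOpposite.op d * e :=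
        eq_sub_of_add_eq' h2.symm
      rw [this]
      exact sub_mem hdI (I.smul_mem (MulOpposite.op d) he)
    have h4 : MulOpposite.op d * f = 0 :=
      (Submodule.disjoint_def.1 hJ.disjoint) _ h3 (J.smul_mem (MulOpposite.op d) hf)
    rw [h4, add_zero] at h2
    exact (congrArg MulOpposite.unop h2).symm
  set E : Module.End R W := e.unop with hE
  have heN : ∀ v, E v ∈ N := he
  have hid : ∀ v, E (E v) = E v := fun v => LinearMap.congr_fun (key E heN) v
  have hN : ∀ v ∈ N, E v = v := by
    by_contra hcon
    push Not at hcon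
    obtain ⟨v, hv, hvne⟩ := hcon
    have hne : N ⊓ LinearMap.ker E ≠ ⊥ := by
      refine (Submodule.ne_bot_iff _).2 ⟨v - E v, ⟨sub_mem hv (heN v), ?_⟩,
        sub_ne_zero.2 (Ne.symm hvne)⟩
      show E (v - E v) = 0
      rw [map_sub, hid, sub_self]
    obtain ⟨d, hd0, hd⟩ := exists_range_le hs _ hne
    apply hd0
    rw [← key d fun v => (hd ⟨v, rfl⟩).1]
    ext v
    exact (hd ⟨v, rfl⟩ : d v ∈ N ⊓ LinearMap.ker E).2
  refine ⟨LinearMap.ker E, ?_, ?_⟩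
  · rw [Submodule.disjoint_def]
    intro x hx hx0
    rw [← hN x hx]
    exact hx0
  · rw [codisjoint_iff, eq_top_iff]
    intro x _
    refine Submodule.mem_sup.2 ⟨E x, heN x, x - E x, ?_, by abel⟩
    show E (x - E x) = 0
    rw [map_sub, hid, sub_self]

end Helpers4

/-- Assume `F` algebraically closed and let `W` be a
`G`-graded simple left `R`-module.  The following are equivalent:
(i) `C(W)` contains a maximal graded subfield isomorphic to the group algebra
of its support `H`, with `|H|` finite and not divisible by `char F`;
(ii) `dim_F C(W)` is finite and not divisible by `char F`.
Under these conditions, `W` is completely reducible as an ungraded module. -/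
theorem statement16 {F : Type*} [Field F] [IsAlgClosed F] {G : Type*} [AddCommGroup G]
    {R : Type*} [Ring R] [Algebra F R]
    {W : Type*} [AddCommGroup W] [Module F W] [Module R W] [IsScalarTower F R W]
    [SMulCommClass R F W]
    (𝒜 : AlgebraGrading F G R) (𝒲 : ModuleGrading 𝒜 (AddMonoidHom.id G) W)
    (hsimple : IsGradedSimpleModule R 𝒲.comp) :
    ((∃ 𝒦 : GradedSubfield (homogComp (R := R) 𝒲.comp), 𝒦.IsMaximal ∧
        𝒦.IsGroupAlgebraOfSupport ∧ 𝒦.support.Finite ∧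
        ¬ (ringChar F ∣ Nat.card ↥𝒦.support)) ↔
      (Module.Finite F (Module.End R W) ∧
        ¬ (ringChar F ∣ Module.finrank F (Module.End R W)))) ∧
    ((Module.Finite F (Module.End R W) ∧
        ¬ (ringChar F ∣ Module.finrank F (Module.End R W))) →
      IsSemisimpleModule R W) := by
  have hW : Nontrivial W := by
    obtain ⟨v, hv⟩ := hsimple.1
    exact ⟨v, 0, hv⟩
  have hnt : Nontrivial (Module.End R W) := inferInstance
  refine ⟨⟨?_, ?_⟩, ?_⟩
  · rintro ⟨𝒦, hmax, hga, hfin, hcard⟩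
    exact one_imp_two (endGrading hsimple) (end_homInv hsimple) 𝒦 hmax hga hfin hcard
  · rintro ⟨hfin, hdim⟩
    exact two_imp_one (endGrading hsimple) (end_homInv hsimple) hdim
  · rintro ⟨hfin, hdim⟩
    refine semisimple_of_end hsimple
      (semisimple_of_finite (endGrading (F := F) hsimple) (end_homInv hsimple) ?_)
    intro h
    exact hdim ((ringChar.spec F _).1 h)

end GradedPaper
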